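/- (Outgoing-path lower bound) Let P = (j_1,…,j_k) be an outgoing path with k vertices (1 ≤ k ≤ n) and let w_P = W({j_1,…,j_k}) be the number of vertices without power after the crew travels through P. Then every repair sequence σ that starts with P has total service disruption time T(σ) ≥ u^F(P) + w_P · s_1 + ∑_{p=2}^{n−k} (n−k+1−p) · s_p. -/

import Mathlib

/-- `W n pre S` is the number of vertices of `V_c = {1,…,n}` without power service
when exactly the vertices in `S` have been repaired: vertices `j` having some
predecessor-or-self `i` (i.e. `pre i j`) that is not in `S`. -/
noncomputable def W (n : ℕ) (pre : ℕ → ℕ → Prop) (S : Finset ℕ) : ℕ :=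
  {j | j ∈ Finset.Icc 1 n ∧ ∃ i ∈ Finset.Icc 1 n, pre i j ∧ i ∉ S}.ncard

/-- `jseq σ p` is the `p`-th visited vertex: the depot `0` for `p = 0`, and `σ p` otherwise. -/
def jseq (σ : ℕ → ℕ) (p : ℕ) : ℕ := if p = 0 then 0 else σ p

/-- Arrival time at the `p`-th visited vertex: `t_p = ∑_{q=1}^p d(j_{q-1}, j_q)`. -/
def arrival (d : ℕ → ℕ → ℝ) (σ : ℕ → ℕ) (p : ℕ) : ℝ :=
  ∑ q ∈ Finset.Icc 1 p, d (jseq σ (q - 1)) (jseq σ q)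

/-- `lastPos n pre σ i = max { p ∈ [1,n] : σ p ⪰ i }`, the position at which the
service of vertex `i` is restored. -/
noncomputable def lastPos (n : ℕ) (pre : ℕ → ℕ → Prop) (σ : ℕ → ℕ) (i : ℕ) : ℕ :=
  sSup {p : ℕ | p ∈ Finset.Icc 1 n ∧ pre (σ p) i}

/-- Total service disruption time `T(σ) = ∑_{i ∈ V_c} r_i` where `r_i = t_{p(i)}`. -/
noncomputable def totalT (n : ℕ) (d : ℕ → ℕ → ℝ) (pre : ℕ → ℕ → Prop) (σ : ℕ → ℕ) : ℝ :=
  ∑ i ∈ Finset.Icc 1 n, arrival d σ (lastPos n pre σ i)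

/-- `uF n d pre k P = u^F(P) = ∑_{p=1}^{k} W({j_1,…,j_{p−1}}) · d(j_{p−1}, j_p)` for an
outgoing path `P = (j_1,…,j_k)` traversed from the depot `j_0 = 0`. -/
noncomputable def uF (n : ℕ) (d : ℕ → ℕ → ℝ) (pre : ℕ → ℕ → Prop) (k : ℕ) (P : ℕ → ℕ) : ℝ :=
  ∑ p ∈ Finset.Icc 1 k, (W n pre ((Finset.Icc 1 (p - 1)).image P) : ℝ) * d (jseq P (p - 1)) (jseq P p)

/-- The multiset of all arc lengths `d(i,j)` over ordered pairs of distinct vertices of `V`. -/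
def arcLengths (n : ℕ) (d : ℕ → ℕ → ℝ) : Multiset ℝ :=
  ((Finset.Icc 0 n ×ˢ Finset.Icc 0 n).filter fun x => x.1 ≠ x.2).val.map fun x => d x.1 x.2

/-- `sArc n d p` is the `p`-th smallest arc length (counted with multiplicity). -/
noncomputable def sArc (n : ℕ) (d : ℕ → ℕ → ℝ) (p : ℕ) : ℝ :=
  ((arcLengths n d).sort (· ≤ ·)).getD (p - 1) 0

open Classical in
/-- Unserved vertices after the first `q - 1` visits are those restored at position `q` or later. -/
lemma W_image_prefix (n : ℕ) (pre : ℕ → ℕ → Prop) (σ : ℕ → ℕ)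
    (hσ : Set.BijOn σ (Set.Icc 1 n) (Set.Icc 1 n)) (q : ℕ) (hq1 : 1 ≤ q) :
    W n pre ((Finset.Icc 1 (q - 1)).image σ) =
      ((Finset.Icc 1 n).filter fun i => q ≤ lastPos n pre σ i).card := by
  rw [W, ← Set.ncard_coe_finset]
  congr 1
  ext j
  simp only [Set.mem_ofPred_eq, Finset.coe_filter, and_congr_right_iff]
  intro hj
  have hbdd : BddAbove {p : ℕ | p ∈ Finset.Icc 1 n ∧ pre (σ p) j} :=
    ⟨n, fun p hp => (Finset.mem_Icc.1 hp.1).2⟩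
  constructor
  · rintro ⟨i, hi, hij, hS⟩
    obtain ⟨p, hp, rfl⟩ := hσ.surjOn (by simpa using hi)
    have hqp : q ≤ p := by
      by_contra! h
      exact hS (Finset.mem_image_of_mem σ (Finset.mem_Icc.2 ⟨hp.1, by omega⟩))
    exact hqp.trans (le_csSup hbdd ⟨Finset.mem_Icc.2 hp, hij⟩)
  · intro h
    have hne : {p : ℕ | p ∈ Finset.Icc 1 n ∧ pre (σ p) j}.Nonempty := by
      by_contra hemp
      rw [Set.not_nonempty_iff_eq_empty] at hemp
      rw [lastPos, hemp] at h
      simp at h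
      omega
    obtain ⟨hm, hpre⟩ := Nat.sSup_mem hne hbdd
    have hm' := Finset.mem_Icc.1 hm
    refine ⟨_, by simpa using hσ.mapsTo hm', hpre, fun hS => ?_⟩
    obtain ⟨p, hp, hpe⟩ := Finset.mem_image.1 hS
    rw [Finset.mem_Icc] at hp
    have h' : q ≤ sSup {p : ℕ | p ∈ Finset.Icc 1 n ∧ pre (σ p) j} := h
    have := hσ.injOn (show p ∈ Set.Icc 1 n from ⟨hp.1, by omega⟩) hm' hpe
    omega

lemma lastPos_le (n : ℕ) (pre : ℕ → ℕ → Prop) (σ : ℕ → ℕ) (i : ℕ) : lastPos n pre σ i ≤ n :=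
  csSup_le' fun _ hp => (Finset.mem_Icc.1 hp.1).2

/-- The total service disruption time counts every arc once per vertex unserved when traversed. -/
lemma totalT_eq_uF (n : ℕ) (d : ℕ → ℕ → ℝ) (pre : ℕ → ℕ → Prop) (σ : ℕ → ℕ)
    (hσ : Set.BijOn σ (Set.Icc 1 n) (Set.Icc 1 n)) :
    totalT n d pre σ = uF n d pre n σ := by
  classical
  have harr : ∀ i, arrival d σ (lastPos n pre σ i) = ∑ q ∈ Finset.Icc 1 n,
      if q ≤ lastPos n pre σ i then d (jseq σ (q - 1)) (jseq σ q) else 0 := by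
    intro i
    rw [← Finset.sum_filter, arrival]
    refine Finset.sum_congr ?_ fun _ _ => rfl
    ext q
    have := lastPos_le n pre σ i
    simp only [Finset.mem_Icc, Finset.mem_filter]
    omega
  simp only [totalT, harr]
  rw [Finset.sum_comm, uF]
  refine Finset.sum_congr rfl fun q hq => ?_
  rw [W_image_prefix n pre σ hσ q (Finset.mem_Icc.1 hq).1, ← Finset.sum_filter,
    Finset.sum_const, nsmul_eq_mul]

lemma le_W (n : ℕ) (pre : ℕ → ℕ → Prop) (hrefl : ∀ i ∈ Finset.Icc 1 n, pre i i) (S : Finset ℕ) :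
    n - S.card ≤ W n pre S := by
  have hsub : (↑(Finset.Icc 1 n \ S) : Set ℕ) ⊆
      {j | j ∈ Finset.Icc 1 n ∧ ∃ i ∈ Finset.Icc 1 n, pre i j ∧ i ∉ S} := by
    intro j hj
    obtain ⟨hj, hS⟩ := Finset.mem_sdiff.1 hj
    exact ⟨hj, j, hj, hrefl j hj, hS⟩
  have hle := Set.ncard_le_ncard hsub
    ((Finset.finite_toSet (Finset.Icc 1 n)).subset fun _ h => h.1)
  rw [Set.ncard_coe_finset] at hle
  have := Finset.le_card_sdiff S (Finset.Icc 1 n)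
  rw [Nat.card_Icc] at this
  rw [W]
  omega

/-- A submultiset of size `l` has sum at least that of the `l` smallest elements. -/
lemma sum_range_sort_le (A M : Multiset ℝ) (h : M ≤ A) :
    ∑ i ∈ Finset.range M.card, (A.sort (· ≤ ·)).getD i 0 ≤ M.sum := by
  have hsub : (M.sort (· ≤ ·)).Sublist (A.sort (· ≤ ·)) := by
    refine List.sublist_of_subperm_of_pairwise (r := (· ≤ ·)) ?_ (Multiset.pairwise_sort _ _)
      (Multiset.pairwise_sort _ _)
    rw [← Multiset.coe_le, Multiset.sort_eq, Multiset.sort_eq]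
    exact h
  have hsum : M.sum = ∑ i ∈ Finset.range M.card, (M.sort (· ≤ ·)).getD i 0 := by
    conv_lhs => rw [← Multiset.sort_eq M (· ≤ ·), Multiset.sum_coe, ← Fin.sum_univ_getElem]
    rw [← Multiset.length_sort (s := M) (r := (· ≤ ·)), ← Fin.sum_univ_eq_sum_range
      (fun i => (M.sort (· ≤ ·)).getD i 0)]
    exact Finset.sum_congr rfl fun i _ => (List.getD_eq_getElem _ _ i.isLt).symm
  rw [hsum]
  refine Finset.sum_le_sum fun i hi => ?_
  obtain ⟨f, hf⟩ := List.sublist_iff_exists_orderEmbedding_getElem?_eq.1 hsub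
  have hiM : i < (M.sort (· ≤ ·)).length := by simpa using hi
  have hfi := hf i
  rw [List.getElem?_eq_getElem hiM] at hfi
  obtain ⟨hfl, hfe⟩ := List.getElem?_eq_some_iff.1 hfi.symm
  have hif : i ≤ f i := f.strictMono.le_apply
  rw [List.getD_eq_getElem _ _ hiM, List.getD_eq_getElem _ _ (hif.trans_lt hfl), ← hfe]
  exact (Multiset.pairwise_sort A (· ≤ ·)).rel_get_of_le (a := ⟨i, _⟩) (b := ⟨f i, _⟩) hif

/-- Abel summation: antitone nonnegative weights preserve domination of prefix sums. -/
lemma sum_mul_le_sum_mul_of_prefix_sum_le (m : ℕ) (c a s : ℕ → ℝ)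
    (hc : ∀ i, i + 1 < m → c (i + 1) ≤ c i) (hc0 : ∀ i < m, 0 ≤ c i)
    (h : ∀ l ≤ m, ∑ i ∈ Finset.range l, s i ≤ ∑ i ∈ Finset.range l, a i) :
    ∑ i ∈ Finset.range m, c i * s i ≤ ∑ i ∈ Finset.range m, c i * a i := by
  have key : ∀ l, l < m → c l * (∑ i ∈ Finset.range (l + 1), a i - ∑ i ∈ Finset.range (l + 1), s i)
      ≤ ∑ i ∈ Finset.range (l + 1), c i * a i - ∑ i ∈ Finset.range (l + 1), c i * s i := by
    intro l
    induction l with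
    | zero => intro _; simp [mul_sub]
    | succ l ih =>
      intro hl
      have h1 := ih (by omega)
      have h2 := mul_le_mul_of_nonneg_right (hc l hl) (sub_nonneg.2 (h (l + 1) (by omega)))
      rw [Finset.sum_range_succ _ (l + 1), Finset.sum_range_succ _ (l + 1),
        Finset.sum_range_succ _ (l + 1), Finset.sum_range_succ _ (l + 1)]
      linarith
  obtain _ | m := m
  · simp
  · have h1 := key m (by omega)
    have h2 := mul_nonneg (hc0 m (by omega)) (sub_nonneg.2 (h (m + 1) le_rfl))
    linarith

/-- Consecutive arcs of a repair sequence have distinct positions among all arcs. -/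
lemma tour_arcs_le_arcLengths (n : ℕ) (d : ℕ → ℕ → ℝ) (σ : ℕ → ℕ)
    (hσ : Set.BijOn σ (Set.Icc 1 n) (Set.Icc 1 n)) (k l : ℕ) (hkl : k + l ≤ n) :
    (Finset.range l).val.map (fun i => d (jseq σ (k + i)) (jseq σ (k + i + 1))) ≤
      arcLengths n d := by
  have hj : ∀ p ≤ n, jseq σ p ∈ Finset.Icc 0 n := by
    intro p hp
    rw [jseq]
    split_ifs with h
    · simp
    · have := hσ.mapsTo (show p ∈ Set.Icc 1 n from ⟨by omega, hp⟩)
      exact Finset.mem_Icc.2 ⟨Nat.zero_le _, this.2⟩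
  have hinj : ∀ p ≤ n, ∀ q ≤ n, jseq σ p = jseq σ q → p = q := by
    intro p hp q hq he
    have hpos : ∀ r ≤ n, r ≠ 0 → σ r ≠ 0 := fun r hr h0 => by
      have := (hσ.mapsTo (show r ∈ Set.Icc 1 n from ⟨by omega, hr⟩)).1
      omega
    by_cases hp0 : p = 0 <;> by_cases hq0 : q = 0 <;>
      simp only [jseq, hp0, hq0, if_true, if_false] at he
    · omega
    · exact absurd he.symm (hpos q hq hq0)
    · exact absurd he (hpos p hp hp0)
    · exact hσ.injOn ⟨by omega, hp⟩ ⟨by omega, hq⟩ he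
  have hnd : ((Finset.range l).val.map
      fun i => (jseq σ (k + i), jseq σ (k + i + 1))).Nodup := by
    refine Multiset.Nodup.map_on (fun i hi i' hi' he => ?_) (Finset.range l).nodup
    have hi := Finset.mem_range.1 hi
    have hi' := Finset.mem_range.1 hi'
    have := hinj (k + i) (by omega) (k + i') (by omega) (Prod.ext_iff.1 he).1
    omega
  have hle : (Finset.range l).val.map (fun i => (jseq σ (k + i), jseq σ (k + i + 1))) ≤
      ((Finset.Icc 0 n ×ˢ Finset.Icc 0 n).filter fun x => x.1 ≠ x.2).val := by
    refine (Multiset.le_iff_subset hnd).2 fun x hx => ?_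
    obtain ⟨i, hi, rfl⟩ := Multiset.mem_map.1 hx
    have hi := Finset.mem_range.1 hi
    refine Finset.mem_filter.2 ⟨Finset.mem_product.2 ⟨hj (k + i) (by omega), hj (k + i + 1) (by omega)⟩, ?_⟩
    intro he
    have := hinj (k + i) (by omega) (k + i + 1) (by omega) he
    omega
  have := Multiset.map_le_map (f := fun x : ℕ × ℕ => d x.1 x.2) hle
  rwa [Multiset.map_map] at this

/-- **Outgoing-path lower bound.** For an outgoing path `P` with `k`
vertices and `w_P = W({j_1,…,j_k})`, every repair sequence `σ` starting with `P`
satisfies `T(σ) ≥ u^F(P) + w_P · s_1 + ∑_{p=2}^{n−k} (n−k+1−p) · s_p`. -/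
theorem stmt11
    (n : ℕ) (hn : 1 ≤ n)
    (d : ℕ → ℕ → ℝ) (hd : ∀ i j, 0 ≤ d i j)
    (pre : ℕ → ℕ → Prop)
    (hrefl : ∀ i ∈ Finset.Icc 1 n, pre i i)
    (htrans : ∀ i j k, pre i j → pre j k → pre i k)
    (hantisymm : ∀ i j, pre i j → pre j i → i = j)
    (σ : ℕ → ℕ) (hσ : Set.BijOn σ (Set.Icc 1 n) (Set.Icc 1 n))
    (k : ℕ) (hk1 : 1 ≤ k) (hk2 : k ≤ n)
    (P : ℕ → ℕ)
    (hPinj : Set.InjOn P (Set.Icc 1 k)) (hPmem : ∀ q ∈ Finset.Icc 1 k, P q ∈ Finset.Icc 1 n)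
    (hstart : ∀ q ∈ Finset.Icc 1 k, σ q = P q) :
    uF n d pre k P + (W n pre ((Finset.Icc 1 k).image P) : ℝ) * sArc n d 1
        + ∑ p ∈ Finset.Icc 2 (n - k), ((n - k + 1 - p : ℕ) : ℝ) * sArc n d p
      ≤ totalT n d pre σ := by
  have hW : ∀ p ≤ n, n - p ≤ W n pre ((Finset.Icc 1 p).image σ) := by
    intro p hp
    have h1 := le_W n pre hrefl ((Finset.Icc 1 p).image σ)
    have h2 : ((Finset.Icc 1 p).image σ).card ≤ p := by
      simpa using Finset.card_image_le (s := Finset.Icc 1 p) (f := σ)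
    omega
  have himg : ∀ p ≤ k, (Finset.Icc 1 p).image σ = (Finset.Icc 1 p).image P := by
    intro p hp
    refine Finset.image_congr fun q hq => hstart q ?_
    have := Finset.mem_Icc.1 hq
    exact Finset.mem_Icc.2 ⟨this.1, by omega⟩
  have hjs : ∀ p ≤ k, jseq σ p = jseq P p := by
    intro p hp
    unfold jseq
    split_ifs with h
    · rfl
    · exact hstart p (Finset.mem_Icc.2 ⟨by omega, hp⟩)
  have huF : uF n d pre k P = uF n d pre k σ := by
    refine Finset.sum_congr rfl fun p hp => ?_
    have := Finset.mem_Icc.1 hp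
    rw [himg _ (by omega), hjs _ (by omega), hjs _ (by omega)]
  obtain ⟨m, rfl⟩ := Nat.exists_eq_add_of_le hk2
  have hsplit : uF (k + m) d pre (k + m) σ = uF (k + m) d pre k σ +
      ∑ i ∈ Finset.range m, (W (k + m) pre ((Finset.Icc 1 (k + i)).image σ) : ℝ) *
        d (jseq σ (k + i)) (jseq σ (k + i + 1)) := by
    have hrange : ∀ (N : ℕ) (f : ℕ → ℝ),
        ∑ p ∈ Finset.Icc 1 N, f p = ∑ i ∈ Finset.range N, f (i + 1) := by
      intro N f
      rw [Finset.range_eq_Ico, Finset.sum_Ico_add' f 0 N 1]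
      rfl
    simp only [uF]
    rw [hrange, hrange, Finset.sum_range_add]
    simp
  rw [totalT_eq_uF _ _ _ _ hσ, hsplit, huF, ← himg k le_rfl, Nat.add_sub_cancel_left, add_assoc]
  refine add_le_add le_rfl ?_
  obtain _ | m := m
  · have h0 : W (k + 0) pre ((Finset.Icc 1 k).image σ) = 0 := by
      rw [W, Set.ncard_eq_zero
        ((Finset.finite_toSet (Finset.Icc 1 (k + 0))).subset fun _ h => h.1)]
      refine Set.eq_empty_of_forall_notMem ?_
      rintro j ⟨-, i, hi, -, hS⟩
      obtain ⟨p, hp, rfl⟩ := hσ.surjOn (by simpa using hi)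
      exact hS (Finset.mem_image_of_mem σ (by simpa using hp))
    rw [h0]
    simp
  set w : ℝ := (W (k + (m + 1)) pre ((Finset.Icc 1 k).image σ) : ℝ) with hw
  let c : ℕ → ℝ := fun i => if i = 0 then w else ((m + 1 - i : ℕ) : ℝ)
  have hwm : ((m + 1 : ℕ) : ℝ) ≤ w := by
    rw [hw]
    have := hW k (by omega)
    exact_mod_cast (by omega : m + 1 ≤ _)
  have hprefix : ∀ l ≤ m + 1, ∑ i ∈ Finset.range l, sArc (k + (m + 1)) d (i + 1) ≤
      ∑ i ∈ Finset.range l, d (jseq σ (k + i)) (jseq σ (k + i + 1)) := by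
    intro l hl
    have := sum_range_sort_le _ _ (tour_arcs_le_arcLengths _ d σ hσ k l (by omega))
    rw [Multiset.card_map, ← Finset.card_def, Finset.card_range] at this
    exact this
  have habel := sum_mul_le_sum_mul_of_prefix_sum_le (m + 1) c _ _ (fun i _ => ?_)
    (fun i _ => ?_) hprefix
  · refine le_trans (le_of_eq ?_) (habel.trans (Finset.sum_le_sum fun i hi => ?_))
    · rw [Finset.sum_range_succ']
      have hI : Finset.Icc 2 (m + 1) = Finset.Ico (0 + 2) (m + 2) := rfl
      rw [hI, ← Finset.sum_Ico_add' (fun p => ((m + 1 + 1 - p : ℕ) : ℝ) *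
        sArc (k + (m + 1)) d p) 0 m 2, ← Finset.range_eq_Ico, add_comm]
      congr 1
      refine Finset.sum_congr rfl fun i _ => ?_
      simp only [c, Nat.succ_ne_zero, if_false]
      congr 2
      omega
    · refine mul_le_mul_of_nonneg_right ?_ (hd _ _)
      simp only [c]
      split_ifs with h
      · subst h
        exact le_rfl
      · have hi := Finset.mem_range.1 hi
        have := hW (k + i) (by omega)
        exact_mod_cast (by omega : m + 1 - i ≤ _)
  · by_cases h : i = 0
    · simp only [c, h, if_true, Nat.succ_ne_zero, if_false]
      refine le_trans ?_ hwm
      exact_mod_cast Nat.sub_le _ _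
    · simp only [c, h, Nat.succ_ne_zero, if_false]
      exact_mod_cast (by omega : m + 1 - (i + 1) ≤ m + 1 - i)
  · simp only [c]
    split_ifs
    · exact le_trans (Nat.cast_nonneg _) hwm
    · exact Nat.cast_nonneg _
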